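/- With the Melnikov functions defined below (via the unique root u_b(r) of K(·;r) in (6/5, 4/3)): the function M̃_f(r) tends to −∞ as r → ∞, and there exists r₀ > 2/3 such that M̂(r) > 0 (in particular M̂(r) ≠ 0) for all r ≥ r₀. -/

import Mathlib

open Filter Topology MeasureTheory

noncomputable section

/-- The Nagumo front profile `φ(χ) = 1/(1 + exp(−χ/√2))`. -/
def phi (χ : ℝ) : ℝ := 1 / (1 + Real.exp (-χ / Real.sqrt 2))

/-- The cubic `K(u;r)`. -/
def Kc (u r : ℝ) : ℝ := 40*u^3 - (50*r + 169)*u^2 + (160*r + 224)*u - 120*r - 96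

/-- `q_{f,+}(r) = 1 + √(r/(r + 1/10))`. -/
def qfp (r : ℝ) : ℝ := 1 + Real.sqrt (r / (r + 1/10))

/-- `q_{f,−}(r) = 1 − √(r/(r + 1/10))`. -/
def qfm (r : ℝ) : ℝ := 1 - Real.sqrt (r / (r + 1/10))

/-- `q_{b,+}(r,u) = 1 + √((r + u − 2)/(r + 1/10))`. -/
def qbp (r u : ℝ) : ℝ := 1 + Real.sqrt ((r + u - 2) / (r + 1/10))

/-- `q_{b,−}(r,u) = 1 − √((r + u − 2)/(r + 1/10))`. -/
def qbm (r u : ℝ) : ℝ := 1 - Real.sqrt ((r + u - 2) / (r + 1/10))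

/-- The singular wave-speed parameter `μ_0(r,u)`. -/
def mu0 (r u : ℝ) : ℝ :=
  (2*(2*qbm r u - qbp r u) + u*(2*qfm r - qfp r)) /
    (qbp r u - 2*qbm r u + qfp r - 2*qfm r)

/-- The singular diffusion coefficient `D_0(r,u)`. -/
def D0 (r u : ℝ) : ℝ :=
  2*(2 - u)^2 / ((r + 1/10) * (2*qbm r u - qbp r u + 2*qfm r - qfp r)^2)

/-- Exponential rate along the front: `a_f = √2(1/2 − q_{f−}/q_{f+})`. -/
def af (r : ℝ) : ℝ := Real.sqrt 2 * (1/2 - qfm r / qfp r)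

/-- Exponential rate along the back: `a_b = √2(1/2 − q_{b−}/q_{b+})`. -/
def ab (r u : ℝ) : ℝ := Real.sqrt 2 * (1/2 - qbm r u / qbp r u)

/-- The basic Melnikov integral `∫ e^{−aχ} φ′(χ)² dχ`. -/
def Jsq (a : ℝ) : ℝ := ∫ χ : ℝ, Real.exp (-a * χ) * (deriv phi χ)^2

/-- The basic Melnikov integral `∫ e^{−aχ} φ′(χ) φ(χ)ⁿ dχ`. -/
def Jn (a : ℝ) (n : ℕ) : ℝ := ∫ χ : ℝ, Real.exp (-a * χ) * (deriv phi χ * (phi χ)^n)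

/-- The Melnikov quantity `M_f(r)` (for `∂_D Q_f`). -/
def Mf (r : ℝ) : ℝ :=
  (qfp r / 2) * Real.sqrt 2 * (qfp r - 2 * qfm r) * Jsq (af r)
    + (1 / (10 * (r + 1/10))) * Jn (af r) 1
    - 2 * qfp r * Jn (af r) 2
    + (qfp r)^2 * Jn (af r) 3

/-- The Melnikov quantity `M_b(r)` (for `∂_D Q_b`), with `u = u_b(r)`. -/
def Mb (r u : ℝ) : ℝ :=
  -(qbp r u / 2) * Real.sqrt 2 * (qbp r u - 2 * qbm r u) * Jsq (ab r u)
    + ((u - 21/10) / (r + 1/10)) * Jn (ab r u) 1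
    + 2 * qbp r u * Jn (ab r u) 2
    - (qbp r u)^2 * Jn (ab r u) 3

/-- The Melnikov quantity `M̂_f(r)` (for `∂_μ Q_f`), with `u = u_b(r)`. -/
def Mhf (r u : ℝ) : ℝ :=
  -(qfp r * D0 r u * Real.sqrt 2 * (qfp r - 2 * qfm r) / (2 * (mu0 r u + 2))) * Jsq (af r)

/-- The Melnikov quantity `M̂_b(r)` (for `∂_μ Q_b`), with `u = u_b(r)`. -/
def Mhb (r u : ℝ) : ℝ :=
  -(qbp r u * Real.sqrt 2 * (qbp r u - 2 * qbm r u) / (2 * (mu0 r u + u))) * Jsq (ab r u)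

/-- The Melnikov quantity `M̃_f(r)` (for `∂_u 𝒬_f`), with `u = u_b(r)`. -/
def Mtf (r u : ℝ) : ℝ :=
  -(qfp r) * Real.sqrt ((r + 1/10) / D0 r u) * Jsq (af r) + Jn (af r) 1

/-- The nondegeneracy quantity `M̂(r) = M_b/M̂_b − M_f/M̂_f`, with `u = u_b(r)`. -/
def Mhat (r u : ℝ) : ℝ := Mb r u / Mhb r u - Mf r / Mhf r u

lemma one_add_exp_pos (χ : ℝ) : 0 < 1 + Real.exp (-χ / Real.sqrt 2) := by positivity

lemma phi_pos (χ : ℝ) : 0 < phi χ := one_div_pos.mpr (one_add_exp_pos χ)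

lemma phi_lt_one (χ : ℝ) : phi χ < 1 := by
  rw [phi, div_lt_one (one_add_exp_pos χ)]
  linarith [Real.exp_pos (-χ / Real.sqrt 2)]

/-- The logistic equation satisfied by the front profile. -/
lemma hasDerivAt_phi (χ : ℝ) :
    HasDerivAt phi (phi χ * (1 - phi χ) / Real.sqrt 2) χ := by
  have h0 := (one_add_exp_pos χ).ne'
  have h2 : Real.sqrt 2 ≠ 0 := by positivity
  have h1 : HasDerivAt (fun x : ℝ => 1 + Real.exp (-x / Real.sqrt 2))
      (Real.exp (-χ / Real.sqrt 2) * (-1 / Real.sqrt 2)) χ :=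
    (((hasDerivAt_id χ).neg.div_const _).exp).const_add 1
  have h3 : HasDerivAt phi _ χ := (hasDerivAt_const χ (1 : ℝ)).div h1 h0
  convert h3 using 1
  unfold phi
  field_simp
  ring

lemma deriv_phi (χ : ℝ) : deriv phi χ = phi χ * (1 - phi χ) / Real.sqrt 2 :=
  (hasDerivAt_phi χ).deriv

lemma deriv_phi_nonneg (χ : ℝ) : 0 ≤ deriv phi χ := by
  rw [deriv_phi]
  have h0 := phi_pos χ
  have h1 := sub_pos.mpr (phi_lt_one χ)
  positivity

lemma continuous_phi : Continuous phi :=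
  continuous_iff_continuousAt.mpr fun χ => (hasDerivAt_phi χ).continuousAt

lemma continuous_deriv_phi : Continuous (deriv phi) := by
  rw [funext deriv_phi]
  exact (continuous_phi.mul (continuous_const.sub continuous_phi)).div_const _

lemma tendsto_phi_atTop : Tendsto phi atTop (𝓝 1) := by
  have h : Tendsto (fun χ : ℝ => -χ / Real.sqrt 2) atTop atBot :=
    tendsto_neg_atTop_atBot.atBot_div_const (by positivity)
  have h1 : Tendsto phi atTop (𝓝 (1 / (1 + 0))) := tendsto_const_nhds.div
    ((Real.tendsto_exp_atBot.comp h).const_add 1) (by norm_num)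
  simpa using h1

lemma tendsto_phi_atBot : Tendsto phi atBot (𝓝 0) := by
  have h : Tendsto (fun χ : ℝ => -χ / Real.sqrt 2) atBot atTop :=
    tendsto_neg_atBot_atTop.atTop_div_const (by positivity)
  exact (tendsto_const_nhds (x := (1 : ℝ))).div_atTop
    (tendsto_atTop_add_const_left _ 1 (Real.tendsto_exp_atTop.comp h))

lemma integrable_deriv_phi : Integrable (deriv phi) := by
  have hd : ∀ x, HasDerivAt phi (deriv phi x) x := fun x =>
    (hasDerivAt_phi x).differentiableAt.hasDerivAt
  refine integrable_of_intervalIntegral_norm_bounded (ι := ℝ) (l := atTop) (a := fun i => -i)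
    (b := id) 1 (fun i => continuous_deriv_phi.integrableOn_Ioc) tendsto_neg_atTop_atBot
    tendsto_id (.of_forall fun i => ?_)
  simp only [Real.norm_eq_abs, abs_of_nonneg (deriv_phi_nonneg _)]
  rw [intervalIntegral.integral_eq_sub_of_hasDerivAt (fun x _ => hd x)
    (continuous_deriv_phi.intervalIntegrable _ _)]
  linarith [phi_pos (-i), phi_lt_one (id i)]

/-- Integration of `φ′ · g(φ)` over the line by the substitution `x = φ(χ)`, in terms of a
primitive `G` of `g`. -/
lemma integral_deriv_phi_mul {g G : ℝ → ℝ} (hG : ∀ x, HasDerivAt G (g x) x)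
    (hg : Integrable fun χ => deriv phi χ * g (phi χ)) :
    ∫ χ, deriv phi χ * g (phi χ) = G 1 - G 0 := by
  have hd : ∀ x, HasDerivAt (fun χ => G (phi χ)) (deriv phi x * g (phi x)) x := fun x => by
    rw [mul_comm]
    exact (hG (phi x)).comp x (hasDerivAt_phi x).differentiableAt.hasDerivAt
  exact integral_of_hasDerivAt_of_tendsto hd hg
    ((hG 0).continuousAt.tendsto.comp tendsto_phi_atBot)
    ((hG 1).continuousAt.tendsto.comp tendsto_phi_atTop)

lemma exp_neg_critical_mul (χ : ℝ) :
    Real.exp (-(1 / Real.sqrt 2) * χ) = (1 - phi χ) / phi χ := by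
  have h0 := (one_add_exp_pos χ).ne'
  have : -(1 / Real.sqrt 2) * χ = -χ / Real.sqrt 2 := by ring
  rw [this, phi]
  field_simp
  ring

lemma exp_neg_mul_mul_phi_le_one {a : ℝ} (h0 : 0 ≤ a) (h1 : a ≤ 1 / Real.sqrt 2) (χ : ℝ) :
    Real.exp (-a * χ) * phi χ ≤ 1 := by
  have hp := phi_pos χ
  have hc := exp_neg_critical_mul χ
  rcases le_total 0 χ with h | h
  · have : Real.exp (-a * χ) ≤ 1 := Real.exp_le_one_iff.mpr (by nlinarith)
    nlinarith [phi_lt_one χ]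
  · have : Real.exp (-a * χ) ≤ (1 - phi χ) / phi χ := by
      rw [← hc]
      exact Real.exp_le_exp.mpr (by nlinarith)
    rw [le_div_iff₀ hp] at this
    linarith

/-- Continuity from the left, at the critical rate `1/√2`, of the weighted integrals of
`φ′ · φ · g(φ)`, together with the value of the limit. -/
lemma tendsto_integral_exp_mul {g G : ℝ → ℝ} (hgc : Continuous g)
    (hg : ∀ x, 0 < x → x < 1 → |g x| ≤ 1)
    (hG : ∀ x, HasDerivAt G ((1 - x) * g x) x) {a : ℝ → ℝ}
    (ha : Tendsto a atTop (𝓝 (1 / Real.sqrt 2))) (ha1 : ∀ᶠ r in atTop, a r ≤ 1 / Real.sqrt 2) :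
    Tendsto (fun r => ∫ χ, Real.exp (-a r * χ) * (deriv phi χ * (phi χ * g (phi χ)))) atTop
      (𝓝 (G 1 - G 0)) := by
  have hint : Integrable fun χ => deriv phi χ * ((1 - phi χ) * g (phi χ)) := by
    refine integrable_deriv_phi.mono' ?_ (.of_forall fun χ => ?_)
    · exact (continuous_deriv_phi.mul ((continuous_const.sub continuous_phi).mul
        (hgc.comp continuous_phi))).aestronglyMeasurable
    · have h1 := hg _ (phi_pos χ) (phi_lt_one χ)
      have h2 : |1 - phi χ| ≤ 1 := by
        rw [abs_le]; constructor <;> linarith [phi_pos χ, phi_lt_one χ]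
      rw [Real.norm_eq_abs, abs_mul, abs_mul, abs_of_nonneg (deriv_phi_nonneg χ)]
      exact mul_le_of_le_one_right (deriv_phi_nonneg χ)
        (mul_le_one₀ h2 (abs_nonneg _) h1)
  rw [← integral_deriv_phi_mul (g := fun x => (1 - x) * g x) hG hint]
  refine tendsto_integral_filter_of_dominated_convergence (deriv phi) ?_ ?_
    integrable_deriv_phi (.of_forall fun χ => ?_)
  · refine .of_forall fun r => Continuous.aestronglyMeasurable ?_
    exact (Real.continuous_exp.comp (continuous_const.mul continuous_id)).mul
      (continuous_deriv_phi.mul (continuous_phi.mul (hgc.comp continuous_phi)))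
  · have ha0 : ∀ᶠ r in atTop, 0 < a r := ha.eventually_const_lt (by positivity)
    filter_upwards [ha0, ha1] with r h0 h1
    refine .of_forall fun χ => ?_
    have hd := deriv_phi_nonneg χ
    have hp := phi_pos χ
    have he := exp_neg_mul_mul_phi_le_one h0.le h1 χ
    have := mul_le_one₀ he (abs_nonneg _) (hg _ hp (phi_lt_one χ))
    rw [Real.norm_eq_abs, abs_mul, abs_mul, abs_mul, abs_of_nonneg hd, abs_of_pos hp, Real.abs_exp]
    calc _ = deriv phi χ * (Real.exp (-a r * χ) * phi χ * |g (phi χ)|) := by ring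
      _ ≤ deriv phi χ := mul_le_of_le_one_right hd this
  · have h1 : deriv phi χ * ((1 - phi χ) * g (phi χ)) =
        Real.exp (-(1 / Real.sqrt 2) * χ) * (deriv phi χ * (phi χ * g (phi χ))) := by
      have := (phi_pos χ).ne'
      rw [exp_neg_critical_mul]
      field_simp
    rw [h1]
    exact ((Real.continuous_exp.tendsto _).comp (ha.neg.mul_const χ)).mul_const _

lemma tendsto_Jn {a : ℝ → ℝ} (ha : Tendsto a atTop (𝓝 (1 / Real.sqrt 2)))
    (ha1 : ∀ᶠ r in atTop, a r ≤ 1 / Real.sqrt 2) (n : ℕ) :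
    Tendsto (fun r => Jn (a r) (n + 1)) atTop (𝓝 (1 / (n + 1) - 1 / (n + 2))) := by
  have h := tendsto_integral_exp_mul (g := fun x => x ^ n)
    (G := fun x => x ^ (n + 1) / (n + 1) - x ^ (n + 2) / (n + 2)) (by fun_prop)
    (fun x h0 h1 => by
      rw [abs_of_nonneg (by positivity)]
      exact pow_le_one₀ h0.le h1.le)
    (fun x => by
      have h1 := (hasDerivAt_pow (n + 1) x).div_const ((n : ℝ) + 1)
      have h2 := (hasDerivAt_pow (n + 2) x).div_const ((n : ℝ) + 2)
      refine (h1.sub h2).congr_deriv ?_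
      have e1 : (n : ℝ) + 1 ≠ 0 := by positivity
      have e2 : (n : ℝ) + 2 ≠ 0 := by positivity
      push_cast
      field_simp
      ring) ha ha1
  have h' : Tendsto (fun r => Jn (a r) (n + 1)) atTop _ :=
    h.congr fun r => by simp only [Jn, pow_succ']
  simpa using h'

lemma tendsto_Jsq {a : ℝ → ℝ} (ha : Tendsto a atTop (𝓝 (1 / Real.sqrt 2)))
    (ha1 : ∀ᶠ r in atTop, a r ≤ 1 / Real.sqrt 2) :
    Tendsto (fun r => Jsq (a r)) atTop (𝓝 (1 / (3 * Real.sqrt 2))) := by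
  have h := tendsto_integral_exp_mul (g := fun x => (1 - x) / Real.sqrt 2)
    (G := fun x => -(1 - x) ^ 3 / (3 * Real.sqrt 2)) (by fun_prop)
    (fun x h0 h1 => by
      have h2 : 1 ≤ Real.sqrt 2 := Real.one_le_sqrt.mpr (by norm_num)
      rw [abs_of_nonneg (div_nonneg (by linarith) (by linarith)), div_le_one (by linarith)]
      linarith)
    (fun x => by
      have h1 := ((((hasDerivAt_id x).const_sub 1).pow 3).neg).div_const (3 * Real.sqrt 2)
      refine h1.congr_deriv ?_
      have : Real.sqrt 2 ≠ 0 := by positivity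
      field_simp
      norm_num) ha ha1
  have h' : Tendsto (fun r => Jsq (a r)) atTop _ := h.congr fun r =>
    integral_congr_ae (.of_forall fun χ => by
      simp only [deriv_phi]
      ring)
  convert h' using 2
  norm_num
  ring

/-- The rate `√2(1/2 − (1−s)/(1+s))` as a function of `s → 1⁻`. -/
lemma tendsto_rate {s : ℝ → ℝ} (hs : Tendsto s atTop (𝓝 1)) :
    Tendsto (fun r => Real.sqrt 2 * (1 / 2 - (1 - s r) / (1 + s r))) atTop
      (𝓝 (1 / Real.sqrt 2)) := by
  have h := ((((hs.const_sub 1).div (hs.const_add 1) (by norm_num)).const_sub (1 / 2)).const_mul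
    (Real.sqrt 2))
  convert (show Tendsto (fun r => Real.sqrt 2 * (1 / 2 - (1 - s r) / (1 + s r))) atTop (𝓝 _)
    from h) using 2
  have h2 : Real.sqrt 2 ^ 2 = 2 := Real.sq_sqrt (by norm_num)
  have : Real.sqrt 2 ≠ 0 := by positivity
  field_simp
  rw [h2]; norm_num

lemma rate_le {s : ℝ} (h0 : 0 ≤ s) (h1 : s ≤ 1) :
    Real.sqrt 2 * (1 / 2 - (1 - s) / (1 + s)) ≤ 1 / Real.sqrt 2 := by
  have h2 : Real.sqrt 2 ^ 2 = 2 := Real.sq_sqrt (by norm_num)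
  have h3 : 0 < Real.sqrt 2 := by positivity
  have h4 : 0 ≤ (1 - s) / (1 + s) := div_nonneg (by linarith) (by linarith)
  rw [le_div_iff₀ h3]
  nlinarith

/-- The root `u_b(r)` tends to `6/5`. -/
lemma tendsto_root {ub : ℝ → ℝ}
    (hub : ∀ r : ℝ, 2/3 < r → ub r ∈ Set.Ioo (6/5 : ℝ) (4/3) ∧ Kc (ub r) r = 0) :
    Tendsto ub atTop (𝓝 (6/5)) := by
  have hu : Tendsto (fun r : ℝ => 6 / 5 + 20 / r) atTop (𝓝 (6/5)) := by
    simpa using (tendsto_const_nhds (x := (6 / 5 : ℝ))).add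
      ((tendsto_const_nhds (x := (20 : ℝ))).div_atTop tendsto_id)
  refine tendsto_of_tendsto_of_tendsto_of_le_of_le' tendsto_const_nhds hu ?_ ?_
  · filter_upwards [eventually_gt_atTop (2 / 3)] with r hr using (hub r hr).1.1.le
  · filter_upwards [eventually_gt_atTop (2 / 3)] with r hr
    obtain ⟨⟨h1, h2⟩, h3⟩ := hub r hr
    have hr0 : 0 < r := by linarith
    rw [← sub_le_iff_le_add', le_div_iff₀ hr0]
    set u := ub r
    have h4 : 50 * r * (u - 6 / 5) * (2 - u) = -(40*u^3 - 169*u^2 + 224*u - 96) := by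
      unfold Kc at h3
      linear_combination h3
    have h5 : -(40*u^3 - 169*u^2 + 224*u - 96) ≤ 400 := by
      have : 0 ≤ u ^ 3 := by positivity
      nlinarith
    have h6 : 0 ≤ r * (u - 6 / 5) := mul_nonneg hr0.le (by linarith)
    nlinarith

theorem stmt16 (ub : ℝ → ℝ)
    (hub : ∀ r : ℝ, 2/3 < r → ub r ∈ Set.Ioo (6/5 : ℝ) (4/3) ∧ Kc (ub r) r = 0) :
    Tendsto (fun r => Mtf r (ub r)) atTop atBot ∧
    ∃ r₀ : ℝ, 2/3 < r₀ ∧ ∀ r : ℝ, r₀ ≤ r →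
      0 < Mhat r (ub r) ∧ Mhat r (ub r) ≠ 0 := by
  have hu := tendsto_root hub
  have hR : Tendsto (fun r : ℝ => r + 1 / 10) atTop atTop :=
    tendsto_atTop_add_const_right _ _ tendsto_id
  have hpos : ∀ᶠ r : ℝ in atTop, 2 / 3 < r := eventually_gt_atTop _
  have h2 : Real.sqrt 2 ≠ 0 := by positivity
  have hsf : Tendsto (fun r : ℝ => Real.sqrt (r / (r + 1 / 10))) atTop (𝓝 1) := by
    have h : Tendsto (fun r : ℝ => 1 - (1 / 10) / (r + 1 / 10)) atTop (𝓝 (1 - 0)) :=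
      (tendsto_const_nhds.div_atTop hR).const_sub 1
    have h' := h.congr' (f₂ := fun r : ℝ => r / (r + 1 / 10)) (by
      filter_upwards [hpos] with r hr
      have : r + 1 / 10 ≠ 0 := by linarith
      field_simp
      ring)
    simpa using h'.sqrt
  have hub0 : Tendsto (fun r : ℝ => (ub r - 21 / 10) / (r + 1 / 10)) atTop (𝓝 0) :=
    (hu.sub_const _).div_atTop hR
  have hsb : Tendsto (fun r : ℝ => Real.sqrt ((r + ub r - 2) / (r + 1 / 10))) atTop (𝓝 1) := by
    have h' := (hub0.const_add 1).congr'
        (f₂ := fun r : ℝ => (r + ub r - 2) / (r + 1 / 10)) (by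
      filter_upwards [hpos] with r hr
      have : r + 1 / 10 ≠ 0 := by linarith
      field_simp
      ring)
    simpa using h'.sqrt
  have haf : Tendsto af atTop (𝓝 (1 / Real.sqrt 2)) := tendsto_rate hsf
  have hab : Tendsto (fun r => ab r (ub r)) atTop (𝓝 (1 / Real.sqrt 2)) := tendsto_rate hsb
  have haf1 : ∀ᶠ r in atTop, af r ≤ 1 / Real.sqrt 2 := by
    filter_upwards [hpos] with r hr
    refine rate_le (Real.sqrt_nonneg _) (Real.sqrt_le_one.mpr ?_)
    rw [div_le_one (by linarith)]
    linarith
  have hab1 : ∀ᶠ r in atTop, ab r (ub r) ≤ 1 / Real.sqrt 2 := by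
    filter_upwards [hpos] with r hr
    refine rate_le (Real.sqrt_nonneg _) (Real.sqrt_le_one.mpr ?_)
    rw [div_le_one (by linarith)]
    linarith [(hub r hr).1.2]
  have hfp : Tendsto qfp atTop (𝓝 (1 + 1)) := hsf.const_add 1
  have hfm : Tendsto qfm atTop (𝓝 (1 - 1)) := hsf.const_sub 1
  have hbp : Tendsto (fun r => qbp r (ub r)) atTop (𝓝 (1 + 1)) := hsb.const_add 1
  have hbm : Tendsto (fun r => qbm r (ub r)) atTop (𝓝 (1 - 1)) := hsb.const_sub 1
  have hJf := tendsto_Jsq haf haf1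
  have hJb := tendsto_Jsq hab hab1
  have hMf : Tendsto Mf atTop (𝓝 (1 / 3)) := by
    have h10 : Tendsto (fun r : ℝ => 1 / (10 * (r + 1 / 10))) atTop (𝓝 0) :=
      tendsto_const_nhds.div_atTop (hR.const_mul_atTop (by norm_num))
    have h := (((((hfp.div_const 2).mul_const (Real.sqrt 2)).mul
      (hfp.sub (hfm.const_mul 2))).mul hJf).add (h10.mul (tendsto_Jn haf haf1 0))).sub
      ((hfp.const_mul 2).mul (tendsto_Jn haf haf1 1)) |>.add
      ((hfp.pow 2).mul (tendsto_Jn haf haf1 2))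
    convert (show Tendsto Mf atTop (𝓝 _) from h) using 2
    field_simp
    norm_num
  have hMb : Tendsto (fun r => Mb r (ub r)) atTop (𝓝 (-1 / 3)) := by
    have h := (((((hbp.div_const 2).neg.mul_const (Real.sqrt 2)).mul
      (hbp.sub (hbm.const_mul 2))).mul hJb).add (hub0.mul (tendsto_Jn hab hab1 0))).add
      ((hbp.const_mul 2).mul (tendsto_Jn hab hab1 1)) |>.sub
      ((hbp.pow 2).mul (tendsto_Jn hab hab1 2))
    convert (show Tendsto (fun r => Mb r (ub r)) atTop (𝓝 _) from h) using 2
    field_simp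
    norm_num
  have hmu : Tendsto (fun r => mu0 r (ub r)) atTop (𝓝 (-8 / 5)) := by
    have h := ((((hbm.const_mul 2).sub hbp).const_mul 2).add
      (hu.mul ((hfm.const_mul 2).sub hfp))).div
      (((hbp.sub (hbm.const_mul 2)).add hfp).sub (hfm.const_mul 2)) (by norm_num)
    convert (show Tendsto (fun r => mu0 r (ub r)) atTop (𝓝 _) from h) using 2
    norm_num
  have hD : Tendsto (fun r => (r + 1 / 10) * D0 r (ub r)) atTop (𝓝 (2 / 25)) := by
    have h := (((hu.const_sub 2).pow 2).const_mul 2).div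
      (((((hbm.const_mul 2).sub hbp).add (hfm.const_mul 2)).sub hfp).pow 2) (by norm_num)
    have h' := h.congr' (f₂ := fun r => (r + 1 / 10) * D0 r (ub r)) (by
      filter_upwards [hpos] with r hr
      have : r + 1 / 10 ≠ 0 := by linarith
      simp only [D0, Pi.div_apply]
      rw [mul_div_assoc', mul_div_mul_left _ _ this])
    convert h' using 2
    norm_num
  have hMhb : Tendsto (fun r => Mhb r (ub r)) atTop (𝓝 (5 / 3)) := by
    have h := ((((hbp.mul_const (Real.sqrt 2)).mul (hbp.sub (hbm.const_mul 2))).div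
      ((hmu.add hu).const_mul 2) (by norm_num)).neg.mul hJb)
    convert (show Tendsto (fun r => Mhb r (ub r)) atTop (𝓝 _) from h) using 2
    field_simp
    norm_num
  have hMhf : Tendsto (fun r => (r + 1 / 10) * Mhf r (ub r)) atTop (𝓝 (-2 / 15)) := by
    have h := (((((hfp.mul hD).mul_const (Real.sqrt 2)).mul (hfp.sub (hfm.const_mul 2))).div
      ((hmu.add_const 2).const_mul 2) (by norm_num)).neg.mul hJf)
    have h' := h.congr (f₂ := fun r => (r + 1 / 10) * Mhf r (ub r)) fun r => by
      simp only [Mhf, Pi.div_apply]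
      ring
    convert h' using 2
    field_simp
    norm_num
  constructor
  · have hsq : Tendsto (fun r => Real.sqrt ((r + 1 / 10) / D0 r (ub r))) atTop atTop := by
      have hi : Tendsto (fun r => Real.sqrt (((r + 1 / 10) * D0 r (ub r))⁻¹)) atTop
          (𝓝 (Real.sqrt ((2 / 25 : ℝ)⁻¹))) := (hD.inv₀ (by norm_num)).sqrt
      refine (hR.atTop_mul_pos (by positivity) hi).congr' ?_
      filter_upwards [hpos] with r hr
      have h0 : 0 < r + 1 / 10 := by linarith
      rw [← Real.sqrt_sq h0.le, ← Real.sqrt_mul (sq_nonneg _), Real.sqrt_sq h0.le]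
      congr 1
      rw [mul_inv, div_eq_mul_inv]
      field_simp
    have h1 := (hsq.atTop_mul_neg (C := -(1 + 1) * (1 / (3 * Real.sqrt 2)))
      (mul_neg_of_neg_of_pos (by norm_num) (by positivity)) (hfp.neg.mul hJf)).atBot_add
      (tendsto_Jn haf haf1 0)
    refine h1.congr fun r => ?_
    simp only [Mtf]
    ring
  · have h : Tendsto (fun r => Mhat r (ub r)) atTop atTop := by
      have hb := hMb.div hMhb (by norm_num)
      have hf := (hMf.div hMhf (by norm_num)).neg
      have h1 := hb.add_atTop (hR.atTop_mul_pos (by norm_num) hf)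
      refine h1.congr' ?_
      filter_upwards [hpos] with r hr
      have : r + 1 / 10 ≠ 0 := by linarith
      simp only [Mhat, Pi.div_apply]
      rw [mul_neg, mul_div_assoc', mul_div_mul_left _ _ this, sub_eq_add_neg]
    obtain ⟨r₁, hr₁⟩ := eventually_atTop.mp (h.eventually_gt_atTop 0)
    refine ⟨max r₁ 1, lt_of_lt_of_le (by norm_num) (le_max_right _ _), fun r hr => ?_⟩
    have := hr₁ r ((le_max_left _ _).trans hr)
    exact ⟨this, this.ne'⟩
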